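/- For all integers m, n with n ≠ 0 (so that F(n) ≠ 0) and every nonnegative integer k: ∑_{j=0}^{k} ∑_{s=0}^{k−j} (-1)^{n·j} · C(k,j) · C(k−j,s) · G(m−(n+1)·k−(n−1)·j+2s) / F(n)^j = G(m) / F(n)^k, where C(k,j) denotes the binomial coefficient. -/

import Mathlib

/-- Two sequences satisfying the Fibonacci recurrence that agree at `0` and `1` are equal. -/
theorem fib_rec_unique {H K : ℤ → ℝ} (hH : ∀ m : ℤ, H m = H (m - 1) + H (m - 2))
    (hK : ∀ m : ℤ, K m = K (m - 1) + K (m - 2)) (h0 : H 0 = K 0) (h1 : H 1 = K 1) (m : ℤ) :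
    H m = K m := by
  suffices h : H m = K m ∧ H (m + 1) = K (m + 1) from h.1
  induction m using Int.induction_on with
  | zero => exact ⟨h0, by simpa using h1⟩
  | succ i ih =>
    have a := hH (i + 1 + 1)
    have b := hK (i + 1 + 1)
    rw [show (i : ℤ) + 1 + 1 - 1 = i + 1 by ring, show (i : ℤ) + 1 + 1 - 2 = i by ring] at a b
    exact ⟨ih.2, by linarith [ih.1, ih.2]⟩
  | pred i ih =>
    have a := hH (-i + 1)
    have b := hK (-i + 1)
    rw [show -(i : ℤ) + 1 - 1 = -i by ring, show -(i : ℤ) + 1 - 2 = -i - 1 by ring] at a b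
    refine ⟨by linarith [ih.1, ih.2], ?_⟩
    rw [sub_add_cancel]
    exact ih.1

/-- The powers of a root of `x ^ 2 = x + 1` satisfy the Fibonacci recurrence. -/
theorem zpow_fib_rec {x : ℝ} (hx : x ^ 2 = x + 1) (m : ℤ) :
    x ^ m = x ^ (m - 1) + x ^ (m - 2) := by
  have h0 : x ≠ 0 := by rintro rfl; norm_num at hx
  have e1 : x ^ m = x ^ (m - 2) * x ^ 2 := by
    rw [← zpow_natCast x 2, ← zpow_add₀ h0]; congr 1; push_cast; ring
  have e2 : x ^ (m - 1) = x ^ (m - 2) * x := by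
    rw [← zpow_add_one₀ h0]; congr 1; ring
  rw [e1, e2, hx]; ring

/-- The powers of a root `x` of `x ^ 2 = x + 1` are given by Fibonacci numbers. -/
theorem zpow_eq_fib {F : ℤ → ℝ} (hF0 : F 0 = 0) (hF1 : F 1 = 1)
    (hF : ∀ m : ℤ, F m = F (m - 1) + F (m - 2)) {x : ℝ} (hx : x ^ 2 = x + 1) (n : ℤ) :
    x ^ n = F n * x + F (n - 1) := by
  refine fib_rec_unique (H := fun n => x ^ n) (K := fun n => F n * x + F (n - 1))
    (zpow_fib_rec hx) (fun m => ?_) ?_ ?_ n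
  · have a := hF m
    have b := hF (m - 1)
    rw [show m - 1 - 2 = m - 2 - 1 by ring] at b
    linear_combination x * a + b
  · have a := hF 1
    norm_num [hF0, hF1] at a ⊢
    linarith
  · simp [hF0, hF1]

/-- The Fibonacci number `F n` as a difference of powers of a root of `x ^ 2 = x + 1`. -/
theorem zpow_sub_zpow_neg_eq_fib {F : ℤ → ℝ} (hF0 : F 0 = 0) (hF1 : F 1 = 1)
    (hF : ∀ m : ℤ, F m = F (m - 1) + F (m - 2)) {x : ℝ} (hx : x ^ 2 = x + 1) (n : ℤ) :
    x ^ n - (-1) ^ n * x ^ (-n) = F n * (x + x⁻¹) := by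
  have h0 : x ≠ 0 := by rintro rfl; norm_num at hx
  have hinv : x⁻¹ = x - 1 := by field_simp; linarith
  have a := zpow_eq_fib hF0 hF1 hF hx n
  have b := zpow_eq_fib hF0 hF1 hF (x := -1 * x⁻¹) (by rw [hinv]; linarith) n
  rw [mul_zpow, inv_zpow'] at b
  rw [a, b]; ring

theorem fib_ne_zero {F : ℤ → ℝ} (hF0 : F 0 = 0) (hF1 : F 1 = 1)
    (hF : ∀ m : ℤ, F m = F (m - 1) + F (m - 2)) {n : ℤ} (hn : n ≠ 0) : F n ≠ 0 := by
  intro h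
  have hx := zpow_sub_zpow_neg_eq_fib hF0 hF1 hF Real.goldenRatio_sq n
  have h0 := Real.goldenRatio_pos
  rw [h, zero_mul, sub_eq_zero] at hx
  have habs := congrArg abs hx
  rw [abs_mul, abs_zpow, abs_zpow, abs_zpow, abs_neg, abs_one, one_zpow, one_mul,
    abs_of_pos h0] at habs
  have := zpow_right_injective₀ h0 Real.one_lt_goldenRatio.ne' habs
  omega

/-- The double binomial sum for the powers of a root of `x ^ 2 = x + 1`. -/
theorem sum_sum_choose_mul_zpow {F : ℤ → ℝ} (hF0 : F 0 = 0) (hF1 : F 1 = 1)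
    (hF : ∀ m : ℤ, F m = F (m - 1) + F (m - 2)) {x : ℝ} (hx : x ^ 2 = x + 1)
    (m : ℤ) {n : ℤ} (hn : n ≠ 0) (k : ℕ) :
    ∑ j ∈ Finset.range (k + 1), ∑ s ∈ Finset.range (k - j + 1),
        (-1 : ℝ) ^ (n * (j : ℤ)) * (Nat.choose k j : ℝ)
          * (Nat.choose (k - j) s : ℝ)
          * x ^ (m - (n + 1) * k - (n - 1) * j + 2 * s) / F n ^ j
      = x ^ m / F n ^ k := by
  have h0 : x ≠ 0 := by rintro rfl; norm_num at hx
  have hFn := fib_ne_zero hF0 hF1 hF hn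
  have key : (-1) ^ n * x ^ (-2 * n) / F n + x ^ (-(n + 1)) * (x ^ 2 + 1) = 1 / F n := by
    have h := zpow_sub_zpow_neg_eq_fib hF0 hF1 hF hx n
    have e1 : x ^ (-2 * n) = x ^ (-n) * x ^ (-n) := by rw [← zpow_add₀ h0]; congr 1; ring
    have e2 : x ^ (-(n + 1)) = x ^ (-n) * x⁻¹ := by
      rw [← zpow_sub_one₀ h0]; congr 1; ring
    have e3 : x ^ (-n) * x ^ n = 1 := by rw [← zpow_add₀ h0]; simp
    have e4 : x⁻¹ * (x ^ 2 + 1) = x + x⁻¹ := by field_simp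
    rw [e1, e2, mul_assoc _ x⁻¹, e4, div_add' _ _ _ hFn]
    congr 1
    linear_combination e3 - x ^ (-n) * h
  rw [div_eq_mul_one_div, ← one_div_pow, ← key, add_pow, Finset.mul_sum]
  refine Finset.sum_congr rfl fun j hj => ?_
  have hjk : j ≤ k := Nat.lt_succ_iff.mp (Finset.mem_range.mp hj)
  rw [mul_pow _ (x ^ 2 + 1), add_pow (x ^ 2) 1, Finset.mul_sum, Finset.mul_sum,
    Finset.sum_mul, Finset.mul_sum]
  refine Finset.sum_congr rfl fun s _ => ?_
  have e : x ^ (m - (n + 1) * k - (n - 1) * j + 2 * s)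
      = x ^ m * (x ^ (-2 * n)) ^ j * (x ^ (-(n + 1))) ^ (k - j) * (x ^ 2) ^ s := by
    simp only [← zpow_natCast, ← zpow_mul, ← zpow_add₀ h0]
    congr 1
    push_cast [Nat.cast_sub hjk]
    ring
  rw [e, div_pow, mul_pow, zpow_mul, zpow_natCast, one_pow]
  ring

/-- Binet's formula for generalized Fibonacci sequences. -/
theorem exists_eq_goldenRatio_zpow {G : ℤ → ℝ} (hG : ∀ m : ℤ, G m = G (m - 1) + G (m - 2)) :
    ∃ a b : ℝ, ∀ m : ℤ, G m = a * Real.goldenRatio ^ m + b * Real.goldenConj ^ m := by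
  have hd : Real.goldenRatio - Real.goldenConj ≠ 0 := by
    rw [Real.goldenRatio_sub_goldenConj]; positivity
  refine ⟨(G 1 - Real.goldenConj * G 0) / (Real.goldenRatio - Real.goldenConj),
    (Real.goldenRatio * G 0 - G 1) / (Real.goldenRatio - Real.goldenConj),
    fib_rec_unique hG (fun m => ?_) ?_ ?_⟩
  · rw [zpow_fib_rec Real.goldenRatio_sq m, zpow_fib_rec Real.goldenConj_sq m]; ring
  · simp only [zpow_zero]; field_simp; ring
  · simp only [zpow_one]; field_simp; ring

/-- Weighted double binomial sum identity for generalized Fibonacci sequences. -/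
theorem stmt_8 (F G : ℤ → ℝ)
    (hF0 : F 0 = 0) (hF1 : F 1 = 1)
    (hF : ∀ m : ℤ, F m = F (m - 1) + F (m - 2))
    (hG : ∀ m : ℤ, G m = G (m - 1) + G (m - 2))
    (m n : ℤ) (hn : n ≠ 0) (k : ℕ) :
    ∑ j ∈ Finset.range (k + 1), ∑ s ∈ Finset.range (k - j + 1),
        (-1 : ℝ) ^ (n * (j : ℤ)) * (Nat.choose k j : ℝ)
          * (Nat.choose (k - j) s : ℝ)
          * G (m - (n + 1) * k - (n - 1) * j + 2 * s) / F n ^ j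
      = G m / F n ^ k := by
  obtain ⟨a, b, hab⟩ := exists_eq_goldenRatio_zpow hG
  rw [hab m, add_div, mul_div_assoc, mul_div_assoc,
    ← sum_sum_choose_mul_zpow hF0 hF1 hF Real.goldenRatio_sq m hn k,
    ← sum_sum_choose_mul_zpow hF0 hF1 hF Real.goldenConj_sq m hn k]
  simp only [Finset.mul_sum, ← Finset.sum_add_distrib]
  refine Finset.sum_congr rfl fun j _ => Finset.sum_congr rfl fun s _ => ?_
  rw [hab]
  ring
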